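/- Distributional Fourier transform of the Fermi–Dirac function: Let β > 0 and let φ : ℝ → ℂ be a Schwartz function with Fourier transform φ̂(k) = ∫_ℝ φ(x)e^{−ikx}dx. Then ∫_ℝ φ̂(x)/(e^{βx} + 1) dx = π·φ(0) + lim_{ε→0⁺} ∫_{|x|>ε} ( iπ / (β·sinh(πx/β)) ) · φ(x) dx, and in particular the principal-value limit on the right exists. -/

import Mathlib

open MeasureTheory Filter Real

/-- The Fourier transform `φ̂(k) = ∫ φ(x) e^{−ikx} dx` of a Schwartz function. -/
noncomputable def fourierT (φ : SchwartzMap ℝ ℂ) (k : ℝ) : ℂ :=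
  ∫ x : ℝ, φ x * Complex.exp (-Complex.I * (k : ℂ) * (x : ℂ))

open scoped FourierTransform

theorem hasSum_coth (t : ℝ) (ht : t ≠ 0) :
    HasSum (fun n : ℕ => 2 * t / (t ^ 2 + ((n : ℝ) + 1) ^ 2))
      (π * (Real.cosh (π * t) / Real.sinh (π * t)) - 1 / t) := by
  have hz : (t * Complex.I : ℂ) ∈ Complex.integerComplement := by
    rw [Complex.mem_integerComplement_iff]
    rintro ⟨n, hn⟩
    have := congrArg Complex.im hn
    simp at this
    exact ht this.symm
  have hsum := (summable_cotTerm hz).hasSum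
  have key : ∑' n, cotTerm (t * Complex.I) n = _ := (cot_series_rep' hz).symm
  rw [key] at hsum
  have h := hsum.mul_left Complex.I
  rw [← Complex.hasSum_ofReal]
  convert! h using 1
  · ext n
    have h1 : ((t : ℂ) ^ 2 + ((n : ℂ) + 1) ^ 2) ≠ 0 := by
      have : t ^ 2 + ((n : ℝ) + 1) ^ 2 ≠ 0 := by positivity
      exact_mod_cast this
    have h2 : (t * Complex.I + ((n : ℂ) + 1)) * (t * Complex.I - ((n : ℂ) + 1)) =
        -((t : ℂ) ^ 2 + ((n : ℂ) + 1) ^ 2) := by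
      linear_combination (t : ℂ) ^ 2 * Complex.I_sq
    rw [cotTerm_identity hz, h2]
    push_cast
    field_simp
    rw [Complex.I_sq]
    ring
  · have hs : Complex.sinh (π * t) ≠ 0 := by
      have : Real.sinh (π * t) ≠ 0 := by
        rw [Real.sinh_ne_zero]; positivity
      exact_mod_cast this
    have ht' : (t : ℂ) ≠ 0 := by exact_mod_cast ht
    rw [Complex.cot, ← mul_assoc, Complex.cos_mul_I, Complex.sin_mul_I]
    push_cast
    have := Complex.I_ne_zero
    field_simp

theorem hasSum_tanh (t : ℝ) :
    HasSum (fun n : ℕ => t / ((2 * (n : ℝ) + 1) ^ 2 + t ^ 2)) (π / 4 * Real.tanh (π * t / 2)) := by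
  rcases eq_or_ne t 0 with rfl | ht
  · simp
  have hall := hasSum_coth t ht
  have heven := (hasSum_coth (t / 2) (by positivity)).mul_left (1 / 2)
  have hodd : Summable (fun n : ℕ => 2 * t / (t ^ 2 + (((2 * n : ℕ) : ℝ) + 1) ^ 2)) :=
    hall.summable.comp_injective (mul_right_injective₀ (two_ne_zero (α := ℕ)))
  have heven' : HasSum (fun n : ℕ => 2 * t / (t ^ 2 + (((2 * n + 1 : ℕ) : ℝ) + 1) ^ 2))
      (1 / 2 * (π * (Real.cosh (π * (t / 2)) / Real.sinh (π * (t / 2))) - 1 / (t / 2))) := by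
    convert! heven using 2 with n
    push_cast
    have h1 : t ^ 2 + (2 * (n : ℝ) + 1 + 1) ^ 2 ≠ 0 := by positivity
    have h2 : (t / 2) ^ 2 + ((n : ℝ) + 1) ^ 2 ≠ 0 := by positivity
    field_simp
    ring
  have hval := (HasSum.even_add_odd (f := fun n : ℕ => 2 * t / (t ^ 2 + ((n : ℝ) + 1) ^ 2))
    hodd.hasSum heven').unique hall
  have hfin := hodd.hasSum.mul_left (1 / 2)
  convert! hfin using 1
  · ext n
    push_cast
    ring
  · rw [eq_sub_of_add_eq hval, show π * t = 2 * (π * t / 2) by ring, Real.cosh_two_mul,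
      Real.sinh_two_mul, Real.tanh_eq_sinh_div_cosh, show π * (t / 2) = π * t / 2 by ring]
    have hs : Real.sinh (π * t / 2) ≠ 0 := by
      rw [Real.sinh_ne_zero]; positivity
    have hc := (Real.cosh_pos (π * t / 2)).ne'
    rw [show 2 * (π * t / 2) / 2 = π * t / 2 by ring]
    field_simp
    ring

theorem hasSum_one_div_sinh {u : ℝ} (hu : 0 < u) :
    HasSum (fun n : ℕ => 2 * Real.exp (-((2 * n + 1) * u))) (1 / Real.sinh u) := by
  have h := (hasSum_geometric_of_lt_one (Real.exp_pos (-(2 * u))).le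
    (Real.exp_lt_one_iff.2 (by linarith))).mul_left (2 * Real.exp (-u))
  convert! h using 1
  · ext n
    rw [← Real.exp_nat_mul, mul_assoc, ← Real.exp_add]
    ring_nf
  · have h1 : 1 - Real.exp (-(2 * u)) ≠ 0 := by
      have := Real.exp_lt_one_iff.2 (show -(2 * u) < 0 by linarith)
      linarith
    have h2 : Real.sinh u = (1 - Real.exp (-(2 * u))) / (2 * Real.exp (-u)) := by
      rw [Real.sinh_eq, eq_div_iff (by positivity)]
      have e1 : Real.exp u * Real.exp (-u) = 1 := by rw [← Real.exp_add]; simp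
      have e2 : Real.exp (-u) * Real.exp (-u) = Real.exp (-(2 * u)) := by
        rw [← Real.exp_add]; ring_nf
      linear_combination e1 - e2
    rw [h2]
    field_simp

theorem div_sinh_le {u : ℝ} (hu : 0 < u) : u / Real.sinh u ≤ 2 * Real.exp (-(u / 2)) := by
  have hs : 0 < Real.sinh u := Real.sinh_pos_iff.2 hu
  have h1 : u / 2 ≤ Real.sinh (u / 2) := Real.self_le_sinh_iff.2 (by linarith)
  have h2 : Real.exp (u / 2) / 2 ≤ Real.cosh (u / 2) := by
    rw [Real.cosh_eq]
    linarith [Real.exp_pos (-(u / 2))]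
  have h3 : Real.sinh u = 2 * Real.sinh (u / 2) * Real.cosh (u / 2) := by
    rw [← Real.sinh_two_mul]; ring_nf
  have h4 : u * Real.exp (u / 2) / 2 ≤ Real.sinh u := by
    rw [h3]
    calc u * Real.exp (u / 2) / 2 = 2 * ((u / 2) * (Real.exp (u / 2) / 2)) := by ring
      _ ≤ 2 * (Real.sinh (u / 2) * Real.cosh (u / 2)) := by gcongr
      _ = _ := by ring
  rw [div_le_iff₀ hs]
  have e1 : Real.exp (u / 2) * Real.exp (-(u / 2)) = 1 := by rw [← Real.exp_add]; simp
  calc u = 2 * Real.exp (-(u / 2)) * (u * Real.exp (u / 2) / 2) := by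
        linear_combination (-u) * e1
    _ ≤ _ := by gcongr

theorem integrableOn_div_sinh {c : ℝ} (hc : 0 < c) :
    IntegrableOn (fun y : ℝ => y / Real.sinh (c * y)) (Set.Ioi 0) := by
  have hdom : IntegrableOn (fun y : ℝ => 2 / c * Real.exp (-(c / 2) * y)) (Set.Ioi 0) :=
    (integrableOn_exp_mul_Ioi (by linarith) 0).const_mul _
  refine hdom.mono' (Measurable.aestronglyMeasurable (by fun_prop)) ?_
  filter_upwards [ae_restrict_mem measurableSet_Ioi] with y hy
  have hy : 0 < y := hy
  have hcy : 0 < c * y := by positivity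
  have hs : 0 < Real.sinh (c * y) := Real.sinh_pos_iff.2 hcy
  rw [Real.norm_of_nonneg (by positivity)]
  calc y / Real.sinh (c * y) = 1 / c * (c * y / Real.sinh (c * y)) := by field_simp
    _ ≤ 1 / c * (2 * Real.exp (-(c * y / 2))) := by gcongr; exact div_sinh_le hcy
    _ = _ := by ring_nf

theorem integral_exp_neg_mul_sin {a : ℝ} (ha : 0 < a) (x : ℝ) :
    ∫ y in Set.Ioi (0 : ℝ), Real.exp (-(a * y)) * Real.sin (x * y) = x / (a ^ 2 + x ^ 2) := by
  have hre : (-(a : ℂ) + x * Complex.I).re < 0 := by simpa using ha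
  have hint := integrableOn_exp_mul_complex_Ioi hre 0
  have h := congrArg Complex.im (integral_exp_mul_complex_Ioi hre 0)
  rw [← RCLike.im_to_complex, ← integral_im hint] at h
  convert! h using 1
  · congr 1
    ext y
    simp [Complex.exp_im]
  · simp [Complex.div_im, Complex.normSq_apply]
    ring

theorem integral_sin_div_sinh {c : ℝ} (hc : 0 < c) (x : ℝ) :
    ∫ y in Set.Ioi (0 : ℝ), Real.sin (x * y) / Real.sinh (c * y) =
      π / (2 * c) * Real.tanh (π * x / (2 * c)) := by
  have hser (y : ℝ) (hy : 0 < y) := hasSum_one_div_sinh (u := c * y) (by positivity)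
  have h := hasSum_integral_of_dominated_convergence (μ := volume.restrict (Set.Ioi (0 : ℝ)))
    (F := fun (n : ℕ) (y : ℝ) => 2 * Real.exp (-((2 * n + 1) * (c * y))) * Real.sin (x * y))
    (f := fun y => 1 / Real.sinh (c * y) * Real.sin (x * y))
    (fun n y => 2 * Real.exp (-((2 * n + 1) * (c * y))) * (|x| * y))
    (fun n => by fun_prop) ?_ ?_ ?_ ?_
  · have h' := (hasSum_tanh (x / c)).mul_left (2 / c)
    have hterm (n : ℕ) : ∫ y in Set.Ioi (0 : ℝ),
        2 * Real.exp (-((2 * n + 1) * (c * y))) * Real.sin (x * y) =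
        2 / c * (x / c / ((2 * (n : ℝ) + 1) ^ 2 + (x / c) ^ 2)) := by
      have := integral_exp_neg_mul_sin (a := (2 * n + 1) * c) (by positivity) x
      simp_rw [mul_assoc (2 : ℝ) (Real.exp _)]
      rw [integral_const_mul]
      simp_rw [← mul_assoc]
      rw [this]
      have h1 : ((2 * (n : ℝ) + 1) * c) ^ 2 + x ^ 2 ≠ 0 := by positivity
      have h2 : (2 * (n : ℝ) + 1) ^ 2 + (x / c) ^ 2 ≠ 0 := by positivity
      field_simp
    simp_rw [hterm] at h
    calc _ = ∫ y in Set.Ioi (0 : ℝ), 1 / Real.sinh (c * y) * Real.sin (x * y) := by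
          congr 1; ext y; ring
      _ = _ := h.unique h'
      _ = _ := by ring_nf
  · intro n
    filter_upwards [ae_restrict_mem measurableSet_Ioi] with y hy
    have hy : 0 < y := hy
    rw [norm_mul, Real.norm_of_nonneg (by positivity)]
    gcongr
    calc ‖Real.sin (x * y)‖ ≤ |x * y| := Real.abs_sin_le_abs
      _ = |x| * y := by rw [abs_mul, abs_of_pos hy]
  · filter_upwards [ae_restrict_mem measurableSet_Ioi] with y hy
    exact ((hser y hy).mul_right _).summable
  · refine ((integrableOn_div_sinh hc).const_mul |x|).congr ?_
    filter_upwards [ae_restrict_mem measurableSet_Ioi] with y hy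
    have := ((hser y hy).mul_right (|x| * y)).tsum_eq
    rw [this]
    ring
  · filter_upwards [ae_restrict_mem measurableSet_Ioi] with y hy
    exact (hser y hy).mul_right _

theorem fourierT_eq_fourier (φ : SchwartzMap ℝ ℂ) (k : ℝ) :
    fourierT φ k = (𝓕 φ) (k / (2 * π)) := by
  rw [SchwartzMap.fourier_coe, Real.fourier_real_eq_integral_exp_smul, fourierT]
  congr 1
  ext x
  have hπ : (π : ℂ) ≠ 0 := by exact_mod_cast Real.pi_ne_zero
  rw [smul_eq_mul, mul_comm]
  congr 2
  push_cast
  field_simp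

theorem continuous_fourierT (φ : SchwartzMap ℝ ℂ) : Continuous (fourierT φ) := by
  rw [funext (fourierT_eq_fourier φ)]
  exact (𝓕 φ).continuous.comp (by fun_prop)

theorem integrable_fourierT (φ : SchwartzMap ℝ ℂ) : Integrable (fourierT φ) := by
  rw [funext (fourierT_eq_fourier φ)]
  exact (𝓕 φ).integrable.comp_div (by positivity)

theorem integrable_abs_mul_norm_fourierT (φ : SchwartzMap ℝ ℂ) :
    Integrable (fun x : ℝ => |x| * ‖fourierT φ x‖) := by
  have h := (((𝓕 φ).integrable_pow_mul volume 1).comp_div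
    (show 2 * π ≠ 0 by positivity)).const_mul (2 * π)
  refine h.congr (Eventually.of_forall fun x => ?_)
  simp only [fourierT_eq_fourier, pow_one, Real.norm_eq_abs, abs_div,
    abs_of_pos (show 0 < 2 * π by positivity)]
  field_simp

theorem integral_fourierT_mul_exp (φ : SchwartzMap ℝ ℂ) (y : ℝ) :
    ∫ x : ℝ, fourierT φ x * Complex.exp (x * y * Complex.I) = 2 * π * φ y := by
  have hinv : φ y = 𝓕⁻ (⇑(𝓕 φ : SchwartzMap ℝ ℂ)) y := by
    rw [← SchwartzMap.fourierInv_coe, FourierTransform.fourierInv_fourier_eq]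
  rw [hinv, Real.fourierInv_eq']
  have h := Measure.integral_comp_div
    (fun v : ℝ => Complex.exp (((2 * π * inner ℝ v y : ℝ) : ℂ) * Complex.I) • (𝓕 φ) v) (2 * π)
  rw [abs_of_pos (show 0 < 2 * π by positivity)] at h
  convert! h using 1
  · congr 1
    ext x
    have hπ : (π : ℂ) ≠ 0 := by exact_mod_cast Real.pi_ne_zero
    rw [fourierT_eq_fourier, smul_eq_mul, mul_comm]
    congr 2
    simp
    field_simp
  · simp

theorem integral_fourierT_mul_sin (φ : SchwartzMap ℝ ℂ) (y : ℝ) :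
    ∫ x : ℝ, (Real.sin (x * y) : ℂ) * fourierT φ x = -Complex.I * π * (φ y - φ (-y)) := by
  have hint (y : ℝ) :
      Integrable (fun x : ℝ => fourierT φ x * Complex.exp (x * y * Complex.I)) := by
    refine (integrable_fourierT φ).mul_bdd (c := 1) (Continuous.aestronglyMeasurable (by fun_prop))
      (Eventually.of_forall fun x => ?_)
    rw [← Complex.ofReal_mul, Complex.norm_exp_ofReal_mul_I]
  have h := integral_sub (hint y) (hint (-y))
  rw [integral_fourierT_mul_exp, integral_fourierT_mul_exp] at h
  have h2 := congrArg (fun z => -Complex.I / 2 * z) h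
  rw [← integral_const_mul] at h2
  convert! h2 using 1
  · congr 1
    ext x
    rw [Complex.ofReal_sin, Complex.sin]
    push_cast
    ring_nf
  · ring

theorem norm_sin_mul_div_sinh_le (c x y : ℝ) :
    ‖Real.sin (x * y) / Real.sinh (c * y)‖ ≤ ‖y / Real.sinh (c * y)‖ * |x| := by
  rw [norm_div, norm_div, div_mul_eq_mul_div]
  gcongr
  calc ‖Real.sin (x * y)‖ ≤ |x * y| := Real.abs_sin_le_abs
    _ = ‖y‖ * |x| := by rw [abs_mul, mul_comm, Real.norm_eq_abs]

theorem integrable_sin_div_sinh_mul_fourierT {c : ℝ} (hc : 0 < c) (φ : SchwartzMap ℝ ℂ) :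
    Integrable (Function.uncurry fun y x : ℝ =>
        ((Real.sin (x * y) / Real.sinh (c * y) : ℝ) : ℂ) * fourierT φ x)
      ((volume.restrict (Set.Ioi 0)).prod volume) := by
  refine ((integrableOn_div_sinh hc).norm.mul_prod
    (integrable_abs_mul_norm_fourierT φ)).mono' ?_ (Eventually.of_forall fun ⟨y, x⟩ => ?_)
  · have := (continuous_fourierT φ).measurable
    refine Measurable.aestronglyMeasurable ?_
    simp only [Function.uncurry_def]
    fun_prop
  · simp only [Function.uncurry_apply_pair]
    rw [norm_mul, Complex.norm_real, ← mul_assoc]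
    gcongr
    exact norm_sin_mul_div_sinh_le c x y

theorem integral_sin_div_sinh_mul_fourierT (c : ℝ) (φ : SchwartzMap ℝ ℂ) (y : ℝ) :
    ∫ x : ℝ, ((Real.sin (x * y) / Real.sinh (c * y) : ℝ) : ℂ) * fourierT φ x =
      -Complex.I * π * ((φ y - φ (-y)) / (Real.sinh (c * y) : ℂ)) := by
  calc _ = ∫ x : ℝ, (1 / (Real.sinh (c * y) : ℂ)) * ((Real.sin (x * y) : ℂ) * fourierT φ x) := by
        congr 1; ext x; push_cast; ring
    _ = _ := by rw [integral_const_mul, integral_fourierT_mul_sin]; ring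

theorem integrableOn_odd_part_div_sinh {c : ℝ} (hc : 0 < c) (φ : SchwartzMap ℝ ℂ) :
    IntegrableOn (fun y : ℝ => (φ y - φ (-y)) / (Real.sinh (c * y) : ℂ)) (Set.Ioi 0) := by
  have h := (integrable_sin_div_sinh_mul_fourierT hc φ).integral_prod_left.const_mul
    (Complex.I / π)
  refine Integrable.congr h (Eventually.of_forall fun y => ?_)
  have hπ : (π : ℂ) ≠ 0 := by exact_mod_cast Real.pi_ne_zero
  simp only [Function.uncurry_apply_pair]
  rw [integral_sin_div_sinh_mul_fourierT, ← mul_assoc]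
  have : Complex.I / π * (-Complex.I * π) = 1 := by
    field_simp
    simp
  rw [this, one_mul]

theorem integral_odd_part_div_sinh {c : ℝ} (hc : 0 < c) (φ : SchwartzMap ℝ ℂ) :
    -Complex.I * π * ∫ y in Set.Ioi (0 : ℝ), (φ y - φ (-y)) / (Real.sinh (c * y) : ℂ) =
      ∫ x : ℝ, ((π / (2 * c) * Real.tanh (π * x / (2 * c)) : ℝ) : ℂ) * fourierT φ x := by
  have h := integral_integral_swap (integrable_sin_div_sinh_mul_fourierT hc φ)
  simp_rw [integral_sin_div_sinh_mul_fourierT, integral_mul_const] at h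
  rw [integral_const_mul] at h
  rw [h]
  congr 1
  ext x
  rw [integral_complex_ofReal, integral_sin_div_sinh hc]

theorem integrableOn_div_sinh_mul_schwartz {c : ℝ} (hc : 0 < c) (φ : SchwartzMap ℝ ℂ) {ε : ℝ}
    (hε : 0 < ε) : IntegrableOn (fun x : ℝ => φ x / (Real.sinh (c * x) : ℂ)) {x | ε < |x|} := by
  have hs : 0 < Real.sinh (c * ε) := Real.sinh_pos_iff.2 (by positivity)
  refine (φ.integrable.norm.const_mul (1 / Real.sinh (c * ε))).integrableOn.mono' ?_ ?_
  · have := φ.continuous.measurable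
    exact Measurable.aestronglyMeasurable (by fun_prop)
  · filter_upwards [ae_restrict_mem (measurableSet_lt measurable_const measurable_abs)] with x hx
    have hx : ε < |x| := hx
    rw [norm_div, Complex.norm_real, Real.norm_eq_abs, Real.abs_sinh, abs_mul, abs_of_pos hc,
      div_mul_eq_mul_div, one_mul]
    gcongr
    exact Real.sinh_le_sinh.2 (by gcongr)

theorem setIntegral_div_sinh_mul_schwartz {c : ℝ} (hc : 0 < c) (φ : SchwartzMap ℝ ℂ) {ε : ℝ}
    (hε : 0 < ε) : ∫ x in {x : ℝ | ε < |x|}, φ x / (Real.sinh (c * x) : ℂ) =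
      ∫ y in Set.Ioi ε, (φ y - φ (-y)) / (Real.sinh (c * y) : ℂ) := by
  have hset : {x : ℝ | ε < |x|} = Set.Iio (-ε) ∪ Set.Ioi ε := by
    ext x
    simp only [Set.mem_ofPred_eq, Set.mem_union, Set.mem_Iio, Set.mem_Ioi, lt_abs]
    constructor <;> rintro (h | h) <;> first | (left; linarith) | (right; linarith)
  have hint := integrableOn_div_sinh_mul_schwartz hc φ hε
  rw [hset] at hint ⊢
  have hneg : IntegrableOn (fun x : ℝ => φ (-x) / (Real.sinh (c * -x) : ℂ)) (Set.Ioi ε) := by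
    have h := ((integrable_indicator_iff
      (measurableSet_Iio.union measurableSet_Ioi)).2 hint).comp_neg.integrableOn (s := Set.Ioi ε)
    refine h.congr_fun (fun x hx => Set.indicator_of_mem ?_ _) measurableSet_Ioi
    exact Set.mem_union_left _ (by simpa using hx)
  rw [setIntegral_union _ measurableSet_Ioi hint.left_of_union hint.right_of_union,
    ← integral_Iic_eq_integral_Iio, ← integral_comp_neg_Ioi,
    ← integral_add hneg hint.right_of_union]
  · congr 1
    ext x
    rw [mul_neg, Real.sinh_neg]
    push_cast
    rw [div_neg]
    ring
  · rw [Set.disjoint_left]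
    intro x hx hx'
    simp only [Set.mem_Iio, Set.mem_Ioi] at hx hx'
    linarith

theorem tendsto_setIntegral_Ioi {f : ℝ → ℂ} (hf : IntegrableOn f (Set.Ioi 0)) :
    Tendsto (fun ε : ℝ => ∫ x in Set.Ioi ε, f x) (nhdsWithin 0 (Set.Ioi 0))
      (nhds (∫ x in Set.Ioi 0, f x)) := by
  simp_rw [← integral_indicator measurableSet_Ioi]
  have hf' := (integrable_indicator_iff measurableSet_Ioi).2 hf
  refine tendsto_integral_filter_of_dominated_convergence
    (fun x => ‖(Set.Ioi (0 : ℝ)).indicator f x‖) ?_ ?_ hf'.norm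
    (Eventually.of_forall fun x => ?_)
  · filter_upwards [self_mem_nhdsWithin] with ε hε
    exact ((integrable_indicator_iff measurableSet_Ioi).2
      (hf.mono_set (Set.Ioi_subset_Ioi (le_of_lt hε)))).aestronglyMeasurable
  · filter_upwards [self_mem_nhdsWithin] with ε hε
    exact Eventually.of_forall fun x =>
      norm_indicator_le_of_subset (Set.Ioi_subset_Ioi (le_of_lt hε)) f x
  · refine tendsto_const_nhds.congr' ?_
    rcases lt_or_ge 0 x with hx | hx
    · filter_upwards [mem_nhdsWithin_of_mem_nhds (Iio_mem_nhds hx)] with ε hε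
      rw [Set.indicator_of_mem (Set.mem_Ioi.2 hx), Set.indicator_of_mem (Set.mem_Ioi.2 hε)]
    · filter_upwards [self_mem_nhdsWithin] with ε hε
      have hε : 0 < ε := hε
      rw [Set.indicator_of_notMem (by simpa using hx),
        Set.indicator_of_notMem (by simp only [Set.mem_Ioi]; linarith)]

theorem one_div_exp_add_one (u : ℝ) :
    1 / (Real.exp u + 1) = 1 / 2 - 1 / 2 * Real.tanh (u / 2) := by
  rw [Real.tanh_eq]
  have h : Real.exp u = Real.exp (u / 2) * Real.exp (u / 2) := by
    rw [← Real.exp_add]; ring_nf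
  have h' : Real.exp (-(u / 2)) = (Real.exp (u / 2))⁻¹ := Real.exp_neg _
  have hp := Real.exp_pos (u / 2)
  rw [h, h']
  field_simp
  ring

theorem integral_fourierT_div_exp_add_one (β : ℝ) (φ : SchwartzMap ℝ ℂ) :
    ∫ x : ℝ, fourierT φ x / ((Real.exp (β * x) + 1 : ℝ) : ℂ) =
      π * φ 0 - 1 / 2 * ∫ x : ℝ, (Real.tanh (β * x / 2) : ℂ) * fourierT φ x := by
  have htanh : Integrable (fun x : ℝ => (Real.tanh (β * x / 2) : ℂ) * fourierT φ x) := by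
    refine (integrable_fourierT φ).bdd_mul (c := 1) ?_ (Eventually.of_forall fun x => ?_)
    · have : Continuous Real.tanh := by
        rw [funext Real.tanh_eq_sinh_div_cosh]
        exact Real.continuous_sinh.div₀ Real.continuous_cosh fun x => (Real.cosh_pos x).ne'
      exact Continuous.aestronglyMeasurable (by fun_prop)
    · rw [Complex.norm_real, Real.norm_eq_abs]
      exact (Real.abs_tanh_lt_one _).le
  have h0 : ∫ x : ℝ, fourierT φ x = 2 * π * φ 0 := by
    simpa using integral_fourierT_mul_exp φ 0
  calc _ = ∫ x : ℝ, (1 / 2 * fourierT φ x -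
          1 / 2 * ((Real.tanh (β * x / 2) : ℂ) * fourierT φ x)) := by
        congr 1
        ext x
        rw [div_eq_mul_one_div, ← Complex.ofReal_one, ← Complex.ofReal_div, one_div_exp_add_one]
        push_cast
        ring
    _ = _ := by
        rw [integral_sub ((integrable_fourierT φ).const_mul _) (htanh.const_mul _),
          integral_const_mul, integral_const_mul, h0]
        ring

/-- Distributional Fourier transform of the Fermi–Dirac function: for `β > 0`,
`∫ φ̂(x)/(e^{βx}+1) dx = π φ(0) + Vp ∫ (iπ/(β sinh(πx/β))) φ(x) dx`,
the principal-value limit on the right existing. -/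
theorem fourier_fermi_dirac (β : ℝ) (hβ : 0 < β) (φ : SchwartzMap ℝ ℂ) :
    ∃ pv : ℂ,
      Tendsto
        (fun ε : ℝ => ∫ x in {x : ℝ | ε < |x|},
          (Complex.I * (π : ℂ) / ((β * Real.sinh (π * x / β) : ℝ) : ℂ)) * φ x)
        (nhdsWithin 0 (Set.Ioi 0)) (nhds pv) ∧
      ∫ x : ℝ, fourierT φ x / ((Real.exp (β * x) + 1 : ℝ) : ℂ) = (π : ℂ) * φ 0 + pv := by
  have hc : 0 < π / β := by positivity
  have hβ' : (β : ℂ) ≠ 0 := by exact_mod_cast hβ.ne'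
  refine ⟨Complex.I * π / β *
    ∫ y in Set.Ioi (0 : ℝ), (φ y - φ (-y)) / (Real.sinh (π / β * y) : ℂ), ?_, ?_⟩
  · refine ((tendsto_setIntegral_Ioi (integrableOn_odd_part_div_sinh hc φ)).const_mul _).congr' ?_
    filter_upwards [self_mem_nhdsWithin] with ε hε
    rw [← setIntegral_div_sinh_mul_schwartz hc φ hε, ← integral_const_mul]
    congr 1
    ext x
    rw [div_mul_eq_mul_div π β x]
    push_cast
    ring
  · have h := integral_odd_part_div_sinh hc φ
    have htanh (x : ℝ) : ((π / (2 * (π / β)) * Real.tanh (π * x / (2 * (π / β))) : ℝ) : ℂ) *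
        fourierT φ x = β / 2 * ((Real.tanh (β * x / 2) : ℂ) * fourierT φ x) := by
      have h1 : π / (2 * (π / β)) = β / 2 := by field_simp
      have h2 : π * x / (2 * (π / β)) = β * x / 2 := by field_simp
      rw [h1, h2]
      push_cast
      ring
    simp_rw [htanh] at h
    rw [integral_const_mul] at h
    rw [integral_fourierT_div_exp_add_one, sub_eq_add_neg]
    congr 1
    have h' := congrArg (fun z : ℂ => -z / β) h
    calc _ = _ := by field_simp
      _ = _ := h'.symm
      _ = _ := by ring
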